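/- Let h be a harmonic homogeneous polynomial of degree m in n real variables and let j ≥ 1. Then Δ(q^j · h) = 2j(n + 2m + 2j − 2) · q^{j−1} · h, where q = Σ_{i=1}^{n} x_i². -/

import Mathlib

open MvPolynomial Finset

/-- The polynomial Laplacian `Δp = ∑ i, ∂²p/∂xᵢ²`. -/
noncomputable def polyLaplacian {n : ℕ} (p : MvPolynomial (Fin n) ℝ) :
    MvPolynomial (Fin n) ℝ :=
  ∑ i : Fin n, pderiv i (pderiv i p)

theorem pderiv_sum_X_sq {n : ℕ} (i : Fin n) :
    pderiv i (∑ k : Fin n, X k ^ 2 : MvPolynomial (Fin n) ℝ) = 2 * X i := by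
  rw [map_sum, Finset.sum_eq_single i]
  · simp
  · intro k _ hk
    simp [pderiv_X_of_ne hk]
  · simp

/-- The commutation rule `Δ(q p) = 2n p + 4 ∑ xᵢ ∂ᵢp + q Δp`, where `q = ∑ xᵢ²`. -/
theorem polyLaplacian_sum_X_sq_mul {n : ℕ} (p : MvPolynomial (Fin n) ℝ) :
    polyLaplacian ((∑ i : Fin n, X i ^ 2) * p) =
      2 * (n : MvPolynomial (Fin n) ℝ) * p + 4 * ∑ i : Fin n, X i * pderiv i p +
        (∑ i : Fin n, X i ^ 2) * polyLaplacian p := by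
  have second_deriv (i : Fin n) :
      pderiv i (pderiv i ((∑ k : Fin n, X k ^ 2) * p)) =
        2 * p + 4 * (X i * pderiv i p) +
          (∑ k : Fin n, X k ^ 2) * pderiv i (pderiv i p) := by
    have pderiv_two : pderiv i (2 : MvPolynomial (Fin n) ℝ) = 0 :=
      (pderiv i).map_natCast 2
    simp only [pderiv_mul, map_add, pderiv_sum_X_sq, pderiv_X_self, pderiv_two]
    ring
  simp only [polyLaplacian, second_deriv, sum_add_distrib, ← mul_sum, sum_const, card_univ,
    Fintype.card_fin, nsmul_eq_mul]
  ring

theorem isHomogeneous_sum_X_sq (n : ℕ) :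
    (∑ i : Fin n, X i ^ 2 : MvPolynomial (Fin n) ℝ).IsHomogeneous 2 :=
  IsHomogeneous.sum _ _ _ fun i _ => isHomogeneous_X_pow i 2

theorem polyLaplacian_sum_X_sq_pow_succ_mul {n m : ℕ} {h : MvPolynomial (Fin n) ℝ}
    (hhom : h.IsHomogeneous m) (hharm : polyLaplacian h = 0) (k : ℕ) :
    polyLaplacian ((∑ i : Fin n, X i ^ 2) ^ (k + 1) * h) =
      ((2 * (k + 1) * (n + 2 * m + 2 * k) : ℕ) : MvPolynomial (Fin n) ℝ) *
        (∑ i : Fin n, X i ^ 2) ^ k * h := by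
  have euler := (((isHomogeneous_sum_X_sq n).pow k).mul hhom).sum_X_mul_pderiv
  rw [pow_succ', mul_assoc, polyLaplacian_sum_X_sq_mul, euler, nsmul_eq_mul]
  cases k with
  | zero =>
    simp only [pow_zero, one_mul, hharm]
    push_cast
    ring
  | succ k =>
    rw [polyLaplacian_sum_X_sq_pow_succ_mul hhom hharm k]
    push_cast
    ring

/-- If `h` is harmonic and homogeneous of degree `m`, then for `j ≥ 1`,
`Δ(qʲ · h) = 2j(n + 2m + 2j - 2) · q^{j-1} · h`, where `q = ∑ xᵢ²`. -/
theorem polyLaplacian_q_pow_mul (n m j : ℕ) (hn : 1 ≤ n) (hj : 1 ≤ j)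
    (h : MvPolynomial (Fin n) ℝ) (hhom : h.IsHomogeneous m)
    (hharm : polyLaplacian h = 0) :
    polyLaplacian ((∑ i : Fin n, X i ^ 2) ^ j * h) =
      (C ((2 * j * (n + 2 * m + 2 * j - 2) : ℕ) : ℝ)) *
        (∑ i : Fin n, X i ^ 2) ^ (j - 1) * h := by
  obtain ⟨k, rfl⟩ := Nat.exists_eq_add_of_le' hj
  have factor : n + 2 * m + 2 * (k + 1) - 2 = n + 2 * m + 2 * k := by omega
  rw [polyLaplacian_sum_X_sq_pow_succ_mul hhom hharm, factor, map_natCast, Nat.add_sub_cancel]
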